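/- arXiv:2110.03556 — 3 statements merged into one kernel-verified Lean document; each statement's English description precedes it below -/
import Mathlib

section
/- Let v₀, …, vₙ be n+1 affinely independent points of ℝⁿ and let a₀, …, aₙ be real numbers, not all zero, with a₀v₀ + ⋯ + aₙvₙ = 0 and aᵢ ≠ 0 for every i. Then among the 2^{n+1} sign vectors e = (e₀, …, eₙ) ∈ {−1, 1}^{n+1}, exactly 2 of them (namely e with eᵢ = sign(aᵢ) for all i, and its negation) satisfy 0 ∈ convexHull{e₀v₀, …, eₙvₙ}. Equivalently, the fraction of sign vectors e for which the simplex with vertices e₀v₀, …, eₙvₙ contains the origin is exactly 2^{−n}. -/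
section SignedDependence

variable {ι E : Type*} [Fintype ι] [AddCommGroup E] [Module ℝ E]

lemma mem_convexHull_range_iff_exists_weights {v : ι → E} {x : E} :
    x ∈ convexHull ℝ (Set.range v) ↔
      ∃ w : ι → ℝ, (∀ i, 0 ≤ w i) ∧ ∑ i, w i = 1 ∧ ∑ i, w i • v i = x := by
  classical
  constructor
  · intro hx
    have hrange : Set.range v =
        Fintype.linearCombination ℝ v '' Set.range fun i : ι => Pi.single i (1 : ℝ) := by
      rw [← Set.range_comp]
      congr 1
      ext i
      simp
    rw [hrange, ← LinearMap.image_convexHull, convexHull_rangle_single_eq_stdSimplex] at hx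
    obtain ⟨w, ⟨hw₀, hw₁⟩, hwx⟩ := hx
    exact ⟨w, hw₀, hw₁, by rwa [Fintype.linearCombination_apply] at hwx⟩
  · rintro ⟨w, hw₀, hw₁, hwx⟩
    exact mem_convexHull_of_exists_fintype w v hw₀ hw₁ Set.mem_range_self hwx

/-- The linear dependences of an affinely independent family are unique up to scaling. -/
lemma AffineIndependent.exists_eq_mul_of_sum_smul_eq_zero {v : ι → E}
    (hv : AffineIndependent ℝ v) {a b : ι → ℝ} (ha : a ≠ 0) (hav : ∑ i, a i • v i = 0)
    (hbv : ∑ i, b i • v i = 0) : ∃ c : ℝ, ∀ i, b i = c * a i := by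
  rw [affineIndependent_iff] at hv
  have hA : ∑ i, a i ≠ 0 := fun h =>
    ha (funext fun i => hv Finset.univ a h hav i (Finset.mem_univ i))
  refine ⟨(∑ i, b i) / ∑ i, a i, fun i => sub_eq_zero.mp ?_⟩
  refine hv Finset.univ (fun i => b i - (∑ i, b i) / (∑ i, a i) * a i) ?_ ?_ i (Finset.mem_univ i)
  · rw [Finset.sum_sub_distrib, ← Finset.mul_sum, div_mul_cancel₀ _ hA, sub_self]
  · simp only [sub_smul, mul_smul, Finset.sum_sub_distrib, ← Finset.smul_sum, hav, hbv,
      smul_zero, sub_zero]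

/-- Rescaling the points of an affinely independent family with dependence `a` by nonzero factors
`e` puts the origin in their convex hull iff the products `e i * a i` all have the same sign. -/
lemma AffineIndependent.zero_mem_convexHull_range_smul_iff [Nonempty ι] {v : ι → E}
    (hv : AffineIndependent ℝ v) {a e : ι → ℝ} (ha : ∀ i, a i ≠ 0) (he : ∀ i, e i ≠ 0)
    (hav : ∑ i, a i • v i = 0) :
    0 ∈ convexHull ℝ (Set.range fun i => e i • v i) ↔
      (∀ i, 0 < e i * a i) ∨ ∀ i, e i * a i < 0 := by
  rw [mem_convexHull_range_iff_exists_weights]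
  constructor
  · rintro ⟨w, hw₀, hw₁, hwv⟩
    obtain ⟨c, hc⟩ := hv.exists_eq_mul_of_sum_smul_eq_zero (b := fun i => w i * e i)
      (fun h => ha (Classical.arbitrary ι) (congrFun h _)) hav (by simpa only [mul_smul] using hwv)
    have hc₀ : c ≠ 0 := by
      rintro rfl
      have hw : ∀ i, w i = 0 := fun i => by simpa [he i] using hc i
      simp [hw] at hw₁
    have hpos : ∀ i, 0 < c * (e i * a i) := fun i => by
      refine lt_of_le_of_ne ?_ (mul_ne_zero hc₀ (mul_ne_zero (he i) (ha i))).symm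
      calc 0 ≤ w i * (e i * e i) := mul_nonneg (hw₀ i) (mul_self_nonneg _)
        _ = c * (e i * a i) := by linear_combination e i * hc i
    rcases hc₀.lt_or_gt with hneg | hpos'
    · exact Or.inr fun i => neg_of_mul_pos_right (hpos i) hneg.le
    · exact Or.inl fun i => pos_of_mul_pos_right (hpos i) hpos'.le
  · intro h
    have hdiv : ∀ i, a i / e i = e i * a i / (e i * e i) := fun i => by
      have := he i
      field_simp
    have hsq : ∀ i, 0 < e i * e i := fun i => mul_self_pos.mpr (he i)
    have hS : ∑ i, a i / e i ≠ 0 ∧ ∀ i, 0 ≤ a i / e i / ∑ i, a i / e i := by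
      rcases h with h | h
      · have hpos : ∀ i, 0 < a i / e i := fun i => hdiv i ▸ div_pos (h i) (hsq i)
        have hS := Finset.sum_pos (fun i _ => hpos i) Finset.univ_nonempty
        exact ⟨hS.ne', fun i => (div_pos (hpos i) hS).le⟩
      · have hneg : ∀ i, a i / e i < 0 := fun i => hdiv i ▸ div_neg_of_neg_of_pos (h i) (hsq i)
        have hS := Finset.sum_neg (fun i _ => hneg i) Finset.univ_nonempty
        exact ⟨hS.ne, fun i => (div_pos_of_neg_of_neg (hneg i) hS).le⟩
    refine ⟨fun i => a i / e i / ∑ i, a i / e i, hS.2, ?_, ?_⟩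
    · rw [← Finset.sum_div, div_self hS.1]
    · have hterm : ∀ i, (a i / e i / ∑ i, a i / e i) • e i • v i =
          (∑ i, a i / e i)⁻¹ • a i • v i := fun i => by
        rw [smul_smul, smul_smul]
        congr 1
        rw [div_mul_eq_mul_div, div_mul_cancel₀ _ (he i), div_eq_inv_mul]
      rw [Finset.sum_congr rfl fun i _ => hterm i, ← Finset.smul_sum, hav, smul_zero]

end SignedDependence

lemma exists_forall_sign_mul_pos_iff {x : ℝ} (hx : x ≠ 0) :
    ∃ s : ({-1, 1} : Set ℝ), ∀ e : ({-1, 1} : Set ℝ), 0 < (e : ℝ) * x ↔ e = s := by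
  rcases hx.lt_or_gt with h | h
  · refine ⟨⟨-1, by simp⟩, ?_⟩
    rintro ⟨e, rfl | rfl⟩
    · simpa using h
    · exact iff_of_false (by simpa using h.le) (by norm_num [Subtype.ext_iff])
  · refine ⟨⟨1, by simp⟩, ?_⟩
    rintro ⟨e, rfl | rfl⟩
    · exact iff_of_false (by simpa using h.le) (by norm_num [Subtype.ext_iff])
    · simpa using h

/-- Let `v₀, …, vₙ` be `n+1` affinely independent points of `ℝⁿ` and
`a₀, …, aₙ` real numbers, all nonzero, with `a₀ v₀ + ⋯ + aₙ vₙ = 0`.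
Then among the `2^(n+1)` sign vectors `e ∈ {-1, 1}^(n+1)`, exactly `2`
satisfy `0 ∈ convexHull {e₀ v₀, …, eₙ vₙ}`; i.e. the fraction of sign
vectors whose sign-flipped simplex contains the origin is `2⁻ⁿ`.
(Key step of Claim 3.3.) -/
theorem card_signVectors_zero_mem_convexHull
    (n : ℕ) (v : Fin (n + 1) → EuclideanSpace ℝ (Fin n))
    (hv : AffineIndependent ℝ v) (a : Fin (n + 1) → ℝ)
    (ha : ∀ i, a i ≠ 0) (hsum : ∑ i, a i • v i = 0) :
    Nat.card {e : Fin (n + 1) → ({-1, 1} : Set ℝ) //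
      0 ∈ convexHull ℝ (Set.range fun i => (e i : ℝ) • v i)} = 2 := by
  have he : ∀ e : ({-1, 1} : Set ℝ), (e : ℝ) ≠ 0 := by
    rintro ⟨e, rfl | rfl⟩ <;> norm_num
  choose s hs using fun i => exists_forall_sign_mul_pos_iff (ha i)
  choose t ht using fun i => exists_forall_sign_mul_pos_iff (neg_ne_zero.mpr (ha i))
  have hst : s ≠ t := fun h => by
    have h₁ := (hs 0 (s 0)).mpr rfl
    have h₂ := (ht 0 (s 0)).mpr (congrFun h 0)
    rw [mul_neg] at h₂
    linarith
  have hset : {e : Fin (n + 1) → ({-1, 1} : Set ℝ) |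
      0 ∈ convexHull ℝ (Set.range fun i => (e i : ℝ) • v i)} = {s, t} := by
    ext e
    simp only [mul_neg, neg_pos] at ht
    rw [Set.mem_ofPred_eq, hv.zero_mem_convexHull_range_smul_iff ha (fun i => he (e i)) hsum]
    simp only [hs, ht, Set.mem_insert_iff, Set.mem_singleton_iff, funext_iff]
  calc _ = Set.ncard {e : Fin (n + 1) → ({-1, 1} : Set ℝ) |
        0 ∈ convexHull ℝ (Set.range fun i => (e i : ℝ) • v i)} := Nat.card_coe_set_eq _
    _ = 2 := by rw [hset, Set.ncard_pair hst]
end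

section
/- Let G be a finite group, let n, N be natural numbers with n ≤ N, and let ρ : G → GL(ℝⁿ) be a linear representation of G on ℝⁿ. Then there exists a map F : G × Fin (N+1) → ℝⁿ that is G-equivariant, i.e., F(g·h, k) = ρ(g)(F(h, k)) for all g, h ∈ G and k ∈ Fin (N+1), such that the number of n-faces covering the origin under F — that is, the number of pairs (s, f) with s ⊆ Fin (N+1), |s| = n+1, f : s → G, and 0 ∈ convexHull{F(f(k), k) : k ∈ s} — is at most 2^{−n} · |G|^{n+1} · C(N+1, n+1), where C(N+1, n+1) is the binomial coefficient. Equivalently, 2ⁿ times the number of such origin-covering n-faces is at most |G|^{n+1} · C(N+1, n+1). -/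
open Finset Module in
/-- For any representation of a finite group there are arbitrarily long finite sequences of vectors
such that translating the entries by group elements never produces a linear relation with at most
`finrank ℝ V` nonzero coefficients. -/
theorem exists_translates_in_general_position {G V : Type*} [Group G] [Finite G]
    [AddCommGroup V] [Module ℝ V] [FiniteDimensional ℝ V] (ρ : Representation ℝ G V) (m : ℕ) :
    ∃ v : Fin m → V, ∀ (f : Fin m → G) (c : Fin m → ℝ), #{k | c k ≠ 0} ≤ finrank ℝ V →
      ∑ k, c k • ρ (f k) (v k) = 0 → c = 0 := by
  classical
  induction m with
  | zero => exact ⟨0, fun _ _ _ _ => Subsingleton.elim _ _⟩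
  | succ m ih =>
    obtain ⟨v, hv⟩ := ih
    let p : {x : (Fin m → G) × Finset (Fin m) // #x.2 < finrank ℝ V} → Submodule ℝ V :=
      fun x => Submodule.span ℝ (x.1.2.image fun k => ρ (x.1.1 k) (v k))
    obtain ⟨u, hu⟩ : ∃ u, ∀ i, u ∉ p i := by
      by_contra! h
      obtain ⟨⟨⟨f, s⟩, hs⟩, hi⟩ := Subspace.exists_eq_top_of_iUnion_eq_univ (p := p)
        (Set.eq_univ_of_forall fun u => Set.mem_iUnion.2 (h u))
      have h1 : finrank ℝ (p ⟨⟨f, s⟩, hs⟩) ≤ #(s.image fun k => ρ (f k) (v k)) :=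
        finrank_span_finset_le_card _
      rw [hi, finrank_top] at h1
      exact absurd (h1.trans card_image_le) (not_le.2 hs)
    refine ⟨Fin.cons u v, fun f c hc h0 => ?_⟩
    rw [Fin.sum_univ_succ] at h0
    simp only [Fin.cons_zero, Fin.cons_succ] at h0
    rw [Fin.card_filter_univ_succ] at hc
    by_cases hc0 : c 0 = 0
    · have ht : (fun k => c (Fin.succ k)) = 0 :=
        hv (fun k => f k.succ) _ (by simpa [hc0] using hc) (by simpa [hc0] using h0)
      funext k
      exact Fin.cases hc0 (fun k => congrFun ht k) k
    · rw [if_pos hc0] at hc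
      refine absurd ?_ (hu ⟨⟨fun k => (f 0)⁻¹ * f k.succ, univ.filter fun k => c (Fin.succ k) ≠ 0⟩,
        Nat.lt_of_succ_le (by simpa [Nat.succ_eq_add_one, add_comm] using hc)⟩)
      have h1 := congrArg (fun x => (c 0)⁻¹ • ρ (f 0)⁻¹ x) h0
      simp only [map_add, map_smul, map_sum, map_zero, smul_zero, smul_add,
        ← Module.End.mul_apply, ← map_mul, inv_mul_cancel, map_one, Module.End.one_apply,
        smul_smul, inv_mul_cancel₀ hc0, one_smul] at h1
      rw [eq_neg_of_add_eq_zero_left h1]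
      refine neg_mem (Submodule.smul_mem _ _ (sum_mem fun k _ => ?_))
      by_cases hk : c k.succ = 0
      · simp [hk]
      · refine Submodule.smul_mem _ _ (Submodule.subset_span ?_)
        exact mem_coe.2 (mem_image_of_mem _ (by simpa using hk))

/-- A point of the convex hull of a finite family is a convex combination of the family. -/
theorem exists_weights_of_mem_convexHull_range {ι V : Type*} [Fintype ι] [AddCommGroup V]
    [Module ℝ V] {w : ι → V} {x : V} (hx : x ∈ convexHull ℝ (Set.range w)) :
    ∃ a : ι → ℝ, (∀ k, 0 ≤ a k) ∧ ∑ k, a k = 1 ∧ ∑ k, a k • w k = x := by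
  classical
  rw [convexHull_range_eq_exists_affineCombination] at hx
  obtain ⟨t, a, ha, h1, h⟩ := hx
  rw [t.affineCombination_eq_linear_combination _ _ h1] at h
  refine ⟨fun k => if k ∈ t then a k else 0, fun k => ?_, by simpa using h1, by simpa using h⟩
  dsimp only
  split_ifs with hk
  exacts [ha k hk, le_rfl]

/-- If every proper subfamily of `w` is linearly independent, then a choice of signs for which the
signed family surrounds the origin is determined by any one of its signs. -/
theorem signs_eq_of_zero_mem_convexHull {ι V : Type*} [Fintype ι] [AddCommGroup V] [Module ℝ V]
    {w : ι → V} (hw : ∀ (c : ι → ℝ) (j : ι), c j = 0 → ∑ k, c k • w k = 0 → c = 0)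
    {σ τ : ι → ℤˣ} {i : ι} (hi : σ i = τ i)
    (hσ : (0 : V) ∈ convexHull ℝ (Set.range fun k => ((σ k : ℤ) : ℝ) • w k))
    (hτ : (0 : V) ∈ convexHull ℝ (Set.range fun k => ((τ k : ℤ) : ℝ) • w k)) : σ = τ := by
  have cast_ne (u : ℤˣ) : ((u : ℤ) : ℝ) ≠ 0 := by simp
  have pos {σ : ι → ℤˣ} {a : ι → ℝ} (ha : ∀ k, 0 ≤ a k) (h1 : ∑ k, a k = 1)
      (h : ∑ k, a k • ((σ k : ℤ) : ℝ) • w k = 0) (j : ι) : 0 < a j := by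
    refine (ha j).lt_of_ne' fun hj => ?_
    have h0 := hw (fun k => a k * ((σ k : ℤ) : ℝ)) j (by simp [hj]) (by simpa [mul_smul] using h)
    have : a = 0 := by
      funext k
      exact (mul_eq_zero.1 (congrFun h0 k)).resolve_right (cast_ne _)
    simp [this] at h1
  obtain ⟨a, ha, ha1, haw⟩ := exists_weights_of_mem_convexHull_range hσ
  obtain ⟨b, hb, hb1, hbw⟩ := exists_weights_of_mem_convexHull_range hτ
  have ha' := pos ha ha1 haw
  have hb' := pos hb hb1 hbw
  have h0 := hw (fun k => b i * (a k * ((σ k : ℤ) : ℝ)) - a i * (b k * ((τ k : ℤ) : ℝ))) i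
    (by rw [hi]; ring) (by
      simp only [sub_smul, mul_smul, Finset.sum_sub_distrib, ← Finset.smul_sum]
      rw [haw, hbw]; simp)
  funext k
  have hk := congrFun h0 k
  have h1 := mul_pos (hb' i) (ha' k)
  have h2 := mul_pos (ha' i) (hb' k)
  simp only [Pi.zero_apply] at hk
  rcases Int.units_eq_one_or (σ k) with h | h <;> rcases Int.units_eq_one_or (τ k) with h' | h' <;>
    simp only [h, h'] at hk ⊢ <;> push_cast at hk <;> exfalso <;> linarith

open Finset in
/-- If two sign vectors in `S` which agree at one point of `s` agree on all of `s`, then `S` has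
density at most `2 ^ (1 - #s)` among all sign vectors. -/
theorem two_pow_mul_card_signs_le {m n : ℕ} {s : Finset (Fin m)} (hs : #s = n + 1)
    (S : Finset (Fin m → ℤˣ))
    (hS : ∀ σ ∈ S, ∀ τ ∈ S, ∀ i ∈ s, σ i = τ i → ∀ k ∈ s, σ k = τ k) :
    2 ^ n * #S ≤ 2 ^ m := by
  obtain ⟨i, hi⟩ : s.Nonempty := card_pos.1 (by omega)
  have hc : #(s.erase i)ᶜ = m - n := by
    rw [card_compl, Fintype.card_fin, card_erase_of_mem hi, hs, Nat.add_sub_cancel]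
  have hn : n ≤ m := by
    have := card_le_univ s
    rw [Fintype.card_fin] at this
    omega
  have key : #S ≤ #(univ : Finset (↥(s.erase i)ᶜ → ℤˣ)) := by
    refine card_le_card_of_injOn (fun σ k => σ k) (fun _ _ => mem_coe.2 (mem_univ _))
      fun σ hσ τ hτ h => ?_
    have hout (k : Fin m) (hk : k ∉ s.erase i) : σ k = τ k :=
      congrFun h ⟨k, mem_compl.2 hk⟩
    funext k
    by_cases hk : k ∈ s
    · exact hS σ hσ τ hτ i hi (hout i (notMem_erase i s)) k hk
    · exact hout k fun h => hk (mem_of_mem_erase h)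
  rw [card_univ, Fintype.card_fun, Fintype.card_coe, hc, Fintype.card_units_int] at key
  calc 2 ^ n * #S ≤ 2 ^ n * 2 ^ (m - n) := Nat.mul_le_mul_left _ key
    _ = 2 ^ m := by rw [← pow_add, Nat.add_sub_cancel' hn]

open Finset in
/-- If every `b ∈ t` is related to at most a proportion `1 / q` of the elements of `α`, then some
`a : α` is related to at most a proportion `1 / q` of the elements of `t`. -/
theorem exists_mul_card_filter_le_card {α β : Type*} [Fintype α] [Nonempty α] (t : Finset β)
    (r : α → β → Prop) [∀ a b, Decidable (r a b)] (q : ℕ)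
    (h : ∀ b ∈ t, q * #{a | r a b} ≤ Fintype.card α) :
    ∃ a, q * #{b ∈ t | r a b} ≤ #t := by
  obtain ⟨a, -, ha⟩ := exists_le_of_sum_le (s := (univ : Finset α)) univ_nonempty
    (f := fun a => q * #{b ∈ t | r a b}) (g := fun _ => #t) (by
      calc ∑ a, q * #{b ∈ t | r a b} = ∑ b ∈ t, q * #{a | r a b} := by
            rw [← mul_sum, ← mul_sum]
            exact congrArg _ (sum_card_bipartiteAbove_eq_sum_card_bipartiteBelow r)
        _ ≤ ∑ _b ∈ t, Fintype.card α := sum_le_sum h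
        _ = ∑ _a : α, #t := by simp [mul_comm])
  exact ⟨a, ha⟩

/-- **Claim 3.3 (face-count form).**  Given a finite group `G`, `n ≤ N`, and a
linear representation `ρ : G → GL(ℝⁿ)`, there is a `G`-equivariant vertex map
`F : G × Fin (N+1) → ℝⁿ` on the join `EG_N = G * ⋯ * G` such that the number
of `n`-faces `(s, f)` (with `s ⊆ Fin (N+1)`, `|s| = n+1`, `f : s → G`) whose
linear extension covers the origin, i.e. `0 ∈ convexHull {F (f k, k) : k ∈ s}`,
is at most `2⁻ⁿ · |G|^(n+1) · C(N+1, n+1)`. -/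
theorem exists_equivariant_map_few_faces_cover_origin
    (G : Type*) [Group G] [Fintype G] (n N : ℕ) (hnN : n ≤ N)
    (ρ : G →* LinearMap.GeneralLinearGroup ℝ (Fin n → ℝ)) :
    ∃ F : G × Fin (N + 1) → (Fin n → ℝ),
      (∀ (g h : G) (k : Fin (N + 1)), F (g * h, k) = (ρ g : (Fin n → ℝ) →ₗ[ℝ] (Fin n → ℝ)) (F (h, k))) ∧
      2 ^ n * Nat.card {p : (s : Finset (Fin (N + 1))) × (↥s → G) //
          p.1.card = n + 1 ∧
          0 ∈ convexHull ℝ (Set.range fun k : ↥p.1 => F (p.2 k, ↑k))}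
        ≤ Fintype.card G ^ (n + 1) * (N + 1).choose (n + 1) := by
  classical
  let r : Representation ℝ G (Fin n → ℝ) := (Units.coeHom _).comp ρ
  obtain ⟨v, hv⟩ := exists_translates_in_general_position r (N + 1)
  rw [Module.finrank_fin_fun] at hv
  let F (σ : Fin (N + 1) → ℤˣ) (x : G × Fin (N + 1)) : Fin n → ℝ :=
    ((σ x.2 : ℤ) : ℝ) • r x.1 (v x.2)
  let faces : Finset ((s : Finset (Fin (N + 1))) × (↥s → G)) :=
    (Finset.univ.powersetCard (n + 1)).sigma fun _ => Finset.univ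
  have hfaces (p) : p ∈ faces ↔ p.1.card = n + 1 := by simp [faces]
  have hcard : faces.card = Fintype.card G ^ (n + 1) * (N + 1).choose (n + 1) := by
    rw [Finset.card_sigma, Finset.sum_congr rfl fun s hs => show _ = Fintype.card G ^ (n + 1) by
      rw [Finset.card_univ, Fintype.card_fun, Fintype.card_coe, (Finset.mem_powersetCard.1 hs).2]]
    simp [mul_comm]
  obtain ⟨σ, hσ⟩ := exists_mul_card_filter_le_card faces
    (fun σ p => (0 : Fin n → ℝ) ∈ convexHull ℝ (Set.range fun k : ↥p.1 => F σ (p.2 k, ↑k)))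
    (2 ^ n) (by
      rintro ⟨s, f⟩ hp
      rw [hfaces] at hp
      dsimp only at hp
      rw [Fintype.card_fun, Fintype.card_fin, Fintype.card_units_int]
      refine two_pow_mul_card_signs_le hp _ fun σ hσ τ hτ i hi hστ k hk => ?_
      rw [Finset.mem_filter] at hσ hτ
      refine congrFun (signs_eq_of_zero_mem_convexHull (w := fun k : ↥s => r (f k) (v k))
        (fun c j hj hc => ?_) (i := ⟨i, hi⟩) (σ := fun k => σ k) (τ := fun k => τ k)
        hστ hσ.2 hτ.2) ⟨k, hk⟩
      let c' (k : Fin (N + 1)) : ℝ := if h : k ∈ s then c ⟨k, h⟩ else 0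
      have hc' : c' = 0 := by
        refine hv (fun k => if h : k ∈ s then f ⟨k, h⟩ else 1) c' ?_ ?_
        · calc _ ≤ (s.erase j).card := Finset.card_le_card fun k hk => ?_
            _ = n := by rw [Finset.card_erase_of_mem j.2, hp, Nat.add_sub_cancel]
          have hk := (Finset.mem_filter.1 hk).2
          have hks : k ∈ s := by
            by_contra h
            exact hk (dif_neg h)
          refine Finset.mem_erase.2 ⟨?_, hks⟩
          rintro rfl
          exact hk ((dif_pos hks).trans hj)
        · rw [← Finset.sum_subset (Finset.subset_univ s) fun k _ hk => by simp [c', hk],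
            ← Finset.sum_coe_sort, ← hc]
          exact Finset.sum_congr rfl fun k _ => by simp [c']
      funext k
      simpa [c'] using congrFun hc' k)
  refine ⟨F σ, fun g h k => ?_, ?_⟩
  · change _ = r g _
    simp [F]
  · rw [← hcard]
    convert hσ using 2
    rw [Nat.card_eq_fintype_card]
    refine Fintype.card_of_subtype _ fun p => ?_
    rw [Finset.mem_filter, hfaces]
end

section
/- Let G be a finite group, let n, N be natural numbers with n ≤ N, and let ρ : G → GL(ℝⁿ) be a linear representation of G on ℝⁿ. Let Z be a set of n-faces of the join model — pairs (s, f) with s ⊆ Fin (N+1), |s| = n+1, f : s → G — that is invariant under the left G-action g • (s, f) = (s, k ↦ g · f(k)). Assume that for every G-equivariant map F : G × Fin (N+1) → ℝⁿ (i.e., F(g·h, k) = ρ(g)(F(h, k)) for all g, h, k) there exists some face (s, f) ∈ Z with 0 ∈ convexHull{F(f(k), k) : k ∈ s}. Then Z contains at least 2ⁿ · |G| faces, i.e., at least 2ⁿ distinct G-orbits of n-faces. -/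
open Finset in
/-- A linear relation is trivial as soon as one coefficient vanishes and the remaining vectors are
linearly independent. -/
lemma LinearIndepOn.eq_zero_of_sum_smul_eq_zero {κ V : Type*} [Fintype κ] [DecidableEq κ]
    [AddCommGroup V] [Module ℝ V] {w : κ → V} {j : κ}
    (hw : LinearIndepOn ℝ w (univ.erase j : Finset κ)) {c : κ → ℝ}
    (hc : ∑ k, c k • w k = 0) (hj : c j = 0) : c = 0 := by
  have hsum : ∑ k ∈ univ.erase j, c k • w k = 0 := by
    rw [← hc]
    exact sum_erase _ (by simp [hj])
  funext k
  by_cases hk : k = j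
  · rw [hk, hj, Pi.zero_apply]
  · exact linearIndepOn_finset_iff.1 hw c hsum k (by simp [hk])

/-- Points of the convex hull of a finite family are convex combinations of the family. -/
lemma exists_mem_stdSimplex_of_mem_convexHull_range {κ V : Type*} [Fintype κ]
    [AddCommGroup V] [Module ℝ V] {w : κ → V} {x : V} (hx : x ∈ convexHull ℝ (Set.range w)) :
    ∃ a ∈ stdSimplex ℝ κ, ∑ k, a k • w k = x := by
  classical
  have hsub : convexHull ℝ (Set.range w) ⊆ Fintype.linearCombination ℝ w '' stdSimplex ℝ κ := by
    refine convexHull_min ?_ ((convex_stdSimplex ℝ κ).linear_image _)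
    rintro _ ⟨k, rfl⟩
    exact ⟨Pi.single k 1, single_mem_stdSimplex ℝ k, by simp⟩
  obtain ⟨a, ha, rfl⟩ := hsub hx
  exact ⟨a, ha, rfl⟩

open Finset in
/-- If all but one of the vectors `w k` are linearly independent, whichever is left out, then
the signs for which the signed family has the origin in its convex hull are unique up to a global
sign. -/
lemma signs_eq_of_zero_mem_convexHull_s5 {κ V : Type*} [Fintype κ] [DecidableEq κ]
    [AddCommGroup V] [Module ℝ V] {w : κ → V}
    (hw : ∀ j, LinearIndepOn ℝ w (univ.erase j : Finset κ)) {ε ε' : κ → ℤˣ}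
    (hε : 0 ∈ convexHull ℝ (Set.range fun k => ((ε k : ℤ) : ℝ) • w k))
    (hε' : 0 ∈ convexHull ℝ (Set.range fun k => ((ε' k : ℤ) : ℝ) • w k))
    {j : κ} (hj : ε j = ε' j) : ε = ε' := by
  have pos : ∀ η : κ → ℤˣ, 0 ∈ convexHull ℝ (Set.range fun k => ((η k : ℤ) : ℝ) • w k) →
      ∃ a : κ → ℝ, (∀ k, 0 < a k) ∧ ∑ k, (a k * ((η k : ℤ) : ℝ)) • w k = 0 := by
    intro η hη
    obtain ⟨a, ⟨ha0, ha1⟩, ha⟩ := exists_mem_stdSimplex_of_mem_convexHull_range hη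
    simp only [smul_smul] at ha
    refine ⟨a, fun k => (ha0 k).lt_of_ne fun hk => ?_, ha⟩
    have h0 := (hw k).eq_zero_of_sum_smul_eq_zero ha (by simp [← hk])
    have : a = 0 := by
      funext i
      have hi := congrFun h0 i
      simpa using hi
    simp [this] at ha1
  obtain ⟨a, ha, hsa⟩ := pos ε hε
  obtain ⟨b, hb, hsb⟩ := pos ε' hε'
  have hrel : ∑ k, (b j * (a k * ((ε k : ℤ) : ℝ)) - a j * (b k * ((ε' k : ℤ) : ℝ))) • w k = 0 := by
    simp only [sub_smul, sum_sub_distrib, mul_smul (b j), mul_smul (a j), ← smul_sum, hsa, hsb,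
      smul_zero, sub_zero]
  have h0 := (hw j).eq_zero_of_sum_smul_eq_zero hrel (by rw [hj]; ring)
  funext k
  have hk := congrFun h0 k
  have h1 := mul_pos (hb j) (ha k)
  have h2 := mul_pos (ha j) (hb k)
  rcases Int.units_eq_one_or (ε k) with e | e <;> rcases Int.units_eq_one_or (ε' k) with e' | e' <;>
    simp only [e, e', Pi.zero_apply, Units.val_one, Units.val_neg, Int.cast_one, Int.cast_neg]
      at hk ⊢ <;> exfalso <;> linarith

open Finset in
/-- Vectors `v i` can be chosen so generically that any at most `finrank ℝ V` of them are linearly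
independent after moving each one by an arbitrary element of a finite group of automorphisms. -/
lemma exists_generic_vectors {ι G V : Type*} [Fintype ι] [Group G] [Finite G]
    [AddCommGroup V] [Module ℝ V] [FiniteDimensional ℝ V]
    (ρ : G →* LinearMap.GeneralLinearGroup ℝ V) :
    ∃ v : ι → V, ∀ t : Finset ι, #t ≤ Module.finrank ℝ V → ∀ g : ι → G,
      LinearIndepOn ℝ (fun i => (ρ (g i) : V →ₗ[ℝ] V) (v i)) (t : Set ι) := by
  classical
  suffices h : ∀ T : Finset ι, ∃ v : ι → V, ∀ t ⊆ T, #t ≤ Module.finrank ℝ V → ∀ g : ι → G,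
      LinearIndepOn ℝ (fun i => (ρ (g i) : V →ₗ[ℝ] V) (v i)) (t : Set ι) by
    obtain ⟨v, hv⟩ := h univ
    exact ⟨v, fun t => hv t (subset_univ t)⟩
  intro T
  induction T using Finset.induction_on with
  | empty =>
    refine ⟨0, fun t ht _ g => ?_⟩
    rw [subset_empty.1 ht, coe_empty]
    exact linearIndepOn_empty _ _
  | insert a T ha ih =>
    obtain ⟨v, hv⟩ := ih
    let p : {t : Finset ι // #t < Module.finrank ℝ V} × (ι → G) → Submodule ℝ V := fun q =>
      (Submodule.span ℝ ((fun i => (ρ (q.2 i) : V →ₗ[ℝ] V) (v i)) '' (q.1 : Finset ι))).comap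
        (ρ (q.2 a) : V →ₗ[ℝ] V)
    obtain ⟨x, hx⟩ : ∃ x, ∀ q, x ∉ p q := by
      by_contra! hcov
      obtain ⟨⟨⟨t, ht⟩, g⟩, hq⟩ := Subspace.exists_eq_top_of_iUnion_eq_univ (p := p)
        (Set.eq_univ_of_forall fun x => Set.mem_iUnion.2 (hcov x))
      have hspan : Submodule.span ℝ
          ((fun i => (ρ (g i) : V →ₗ[ℝ] V) (v i)) '' (t : Set ι)) = ⊤ := by
        refine eq_top_iff.2 fun y _ => ?_
        have hy : (ρ (g a) : V →ₗ[ℝ] V) ((ρ (g a)⁻¹ : V →ₗ[ℝ] V) y) = y := by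
          rw [← Module.End.mul_apply, ← Units.val_mul, ← map_mul]
          simp
        have hmem : (ρ (g a)⁻¹ : V →ₗ[ℝ] V) y ∈ p ⟨⟨t, ht⟩, g⟩ := hq ▸ Submodule.mem_top
        rw [← hy]
        exact hmem
      have hcard := finrank_span_finset_le_card (R := ℝ)
        (t.image fun i => (ρ (g i) : V →ₗ[ℝ] V) (v i))
      rw [coe_image, Set.finrank, hspan, finrank_top] at hcard
      exact absurd (hcard.trans card_image_le) (not_le.2 ht)
    refine ⟨Function.update v a x, fun t ht htc g => ?_⟩
    have agree : ∀ u : Finset ι, a ∉ u →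
        Set.EqOn (fun i => (ρ (g i) : V →ₗ[ℝ] V) (v i))
          (fun i => (ρ (g i) : V →ₗ[ℝ] V) (Function.update v a x i)) u := by
      intro u hu i hi
      have : i ≠ a := fun h => hu (h ▸ hi)
      simp [this]
    have hsub : t.erase a ⊆ T := by
      rw [← erase_insert ha]
      exact erase_subset_erase a ht
    have hind : LinearIndepOn ℝ (fun i => (ρ (g i) : V →ₗ[ℝ] V) (Function.update v a x i))
        (t.erase a : Set ι) :=
      (linearIndepOn_congr (agree _ (notMem_erase a t))).1
        (hv _ hsub ((card_le_card (erase_subset a t)).trans htc) g)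
    by_cases hat : a ∈ t
    · have hlt : #(t.erase a) < Module.finrank ℝ V := (card_erase_lt_of_mem hat).trans_le htc
      rw [← insert_erase hat, coe_insert]
      refine hind.insert ?_
      rw [← (agree _ (notMem_erase a t)).image_eq]
      simpa [p] using hx ⟨⟨t.erase a, hlt⟩, g⟩
    · rwa [erase_eq_of_notMem hat] at hind

open Finset in
/-- A set of sign vectors which are determined by their entries off `t` is small. -/
lemma card_signs_mul_two_pow_le {ι : Type*} [Fintype ι] [DecidableEq ι] (t : Finset ι)
    (H : Finset (ι → ℤˣ))
    (hH : ∀ ε ∈ H, ∀ ε' ∈ H, (∀ i ∉ t, ε i = ε' i) → ε = ε') :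
    #H * 2 ^ #t ≤ 2 ^ Fintype.card ι := by
  have hle : #H ≤ Fintype.card ({i // i ∉ t} → ℤˣ) := by
    refine card_le_card_of_injOn (t := univ) (fun ε i => ε i) (fun _ _ => mem_univ _) ?_
    intro ε hε ε' hε' h
    exact hH ε hε ε' hε' fun i hi => congrFun h ⟨i, hi⟩
  have hcard : Fintype.card ({i // i ∉ t} → ℤˣ) = 2 ^ (Fintype.card ι - #t) := by
    simp [Fintype.card_subtype_compl]
  rw [hcard] at hle
  calc #H * 2 ^ #t ≤ 2 ^ (Fintype.card ι - #t) * 2 ^ #t := Nat.mul_le_mul_right _ hle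
    _ = 2 ^ Fintype.card ι := by rw [← pow_add, Nat.sub_add_cancel (card_le_univ t)]

/-- **Corollary 3.4 (combinatorial form).**  Let `G` be a finite group,
`n ≤ N`, and `ρ : G → GL(ℝⁿ)` a linear representation.  Let `Z` be a
`G`-invariant set of `n`-faces of the join `EG_N = G * ⋯ * G`, where an
`n`-face is a pair `(s, f)` with `s ⊆ Fin (N+1)`, `|s| = n+1`, `f : s → G`
(encoded as a sigma type), and `G` acts on faces by
`g • (s, f) = (s, k ↦ g * f k)`.  Assume that every `G`-equivariant vertex
map `F : G × Fin (N+1) → ℝⁿ` covers the origin on some face of `Z`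
(the operational consequence of the non-vanishing of the equivariant Euler
class on `Z`).  Then `Z` contains at least `2ⁿ · |G|` faces, i.e. at least
`2ⁿ` distinct `G`-orbits of `n`-faces. -/
theorem card_lower_bound_of_equivariant_maps_cover_origin
    (G : Type*) [Group G] [Fintype G] (n N : ℕ) (hnN : n ≤ N)
    (ρ : G →* LinearMap.GeneralLinearGroup ℝ (Fin n → ℝ))
    (Z : Set ((s : Finset (Fin (N + 1))) × (↥s → G)))
    (hdim : ∀ p ∈ Z, p.1.card = n + 1)
    (hinv : ∀ (g : G), ∀ p ∈ Z,
      (⟨p.1, fun k => g * p.2 k⟩ : (s : Finset (Fin (N + 1))) × (↥s → G)) ∈ Z)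
    (hhit : ∀ F : G × Fin (N + 1) → (Fin n → ℝ),
      (∀ (g h : G) (k : Fin (N + 1)),
        F (g * h, k) = (ρ g : (Fin n → ℝ) →ₗ[ℝ] (Fin n → ℝ)) (F (h, k))) →
      ∃ p ∈ Z, 0 ∈ convexHull ℝ (Set.range fun k : ↥p.1 => F (p.2 k, ↑k))) :
    2 ^ n * Fintype.card G ≤ Z.ncard := by
  classical
  obtain ⟨v, hv⟩ := exists_generic_vectors (ι := Fin (N + 1)) ρ
  let F : (Fin (N + 1) → ℤˣ) → G × Fin (N + 1) → (Fin n → ℝ) := fun ε q =>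
    ((ε q.2 : ℤ) : ℝ) • (ρ q.1 : (Fin n → ℝ) →ₗ[ℝ] (Fin n → ℝ)) (v q.2)
  have hF : ∀ ε (g h : G) (k : Fin (N + 1)),
      F ε (g * h, k) = (ρ g : (Fin n → ℝ) →ₗ[ℝ] (Fin n → ℝ)) (F ε (h, k)) := by
    intro ε g h k
    simp [F]
  let covers : (Fin (N + 1) → ℤˣ) → ((s : Finset (Fin (N + 1))) × (↥s → G)) → Prop := fun ε p =>
    0 ∈ convexHull ℝ (Set.range fun k : ↥p.1 => F ε (p.2 k, ↑k))
  have lower : ∀ ε ∈ (Finset.univ : Finset (Fin (N + 1) → ℤˣ)),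
      Fintype.card G ≤ (Z.toFinset.bipartiteAbove covers ε).card := by
    intro ε _
    obtain ⟨p, hpZ, hp⟩ := hhit (F ε) (hF ε)
    obtain ⟨j, hj⟩ : p.1.Nonempty := Finset.card_pos.1 (by rw [hdim p hpZ]; omega)
    rw [← Finset.card_univ]
    refine Finset.card_le_card_of_injOn (fun g => ⟨p.1, fun k => g * p.2 k⟩) ?_ ?_
    · intro g _
      simp only [Finset.coe_bipartiteAbove, Set.mem_toFinset, Set.mem_ofPred_eq]
      refine ⟨hinv g p hpZ, ?_⟩
      have himg := Set.mem_image_of_mem (ρ g : (Fin n → ℝ) →ₗ[ℝ] (Fin n → ℝ)) hp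
      rw [LinearMap.image_convexHull, map_zero, ← Set.range_comp] at himg
      simpa only [covers, hF] using! himg
    · intro g _ g' _ h
      have h' := congrFun (eq_of_heq (Sigma.mk.inj h).2) ⟨j, hj⟩
      exact mul_right_cancel h'
  have upper : ∀ p ∈ Z.toFinset,
      ((Finset.univ : Finset (Fin (N + 1) → ℤˣ)).bipartiteBelow covers p).card * 2 ^ n ≤
        2 ^ (N + 1) := by
    rintro ⟨s, f⟩ hp
    have hs : s.card = n + 1 := hdim _ (Set.mem_toFinset.1 hp)
    obtain ⟨j, hj⟩ : s.Nonempty := Finset.card_pos.1 (by omega)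
    have ht : (s.erase j).card = n := by rw [Finset.card_erase_of_mem hj, hs, Nat.add_sub_cancel]
    have hw : ∀ i : ↥s, LinearIndepOn ℝ
        (fun k : ↥s => (ρ (f k) : (Fin n → ℝ) →ₗ[ℝ] (Fin n → ℝ)) (v k))
        (Finset.univ.erase i : Finset ↥s) := by
      intro i
      have hcard : (s.erase i).card ≤ Module.finrank ℝ (Fin n → ℝ) := by
        rw [Finset.card_erase_of_mem i.2, hs, Module.finrank_fin_fun, Nat.add_sub_cancel]
      have hind := hv (s.erase i) hcard fun k => if h : k ∈ s then f ⟨k, h⟩ else 1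
      have hmem : ∀ k : ((Finset.univ.erase i : Finset ↥s) : Set ↥s),
          ((k : ↥s) : Fin (N + 1)) ∈ (s.erase i : Set (Fin (N + 1))) := by
        rintro ⟨k, hk⟩
        exact Finset.mem_erase.2 ⟨fun h => (Finset.mem_erase.1 hk).1 (Subtype.ext h), k.2⟩
      have hcomp := LinearIndependent.comp hind (fun k => ⟨_, hmem k⟩) fun k k' h =>
        Subtype.ext (Subtype.ext (Subtype.mk.inj h))
      simpa [LinearIndepOn, Function.comp_def] using hcomp
    have hmain := card_signs_mul_two_pow_le (s.erase j)
      ((Finset.univ : Finset (Fin (N + 1) → ℤˣ)).bipartiteBelow covers ⟨s, f⟩) ?_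
    · rwa [ht, Fintype.card_fin] at hmain
    intro ε hε ε' hε' hoff
    have hres := signs_eq_of_zero_mem_convexHull_s5 hw (ε := fun k => ε k) (ε' := fun k => ε' k)
      ((Finset.mem_bipartiteBelow covers).1 hε).2 ((Finset.mem_bipartiteBelow covers).1 hε').2
      (j := ⟨j, hj⟩) (hoff j (Finset.notMem_erase j s))
    funext i
    by_cases hi : i ∈ s
    · exact congrFun hres ⟨i, hi⟩
    · exact hoff i fun h => hi (Finset.mem_of_mem_erase h)
  have upper' : ∀ p ∈ Z.toFinset,
      ((Finset.univ : Finset (Fin (N + 1) → ℤˣ)).bipartiteBelow covers p).card ≤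
        2 ^ (N + 1 - n) := by
    intro p hp
    refine Nat.le_of_mul_le_mul_right ?_ (pow_pos two_pos n)
    rw [← pow_add, Nat.sub_add_cancel (by omega)]
    exact upper p hp
  have hcount := Finset.card_mul_le_card_mul covers lower upper'
  have hsigns : (Finset.univ : Finset (Fin (N + 1) → ℤˣ)).card = 2 ^ (N + 1 - n) * 2 ^ n := by
    rw [← pow_add, Nat.sub_add_cancel (by omega)]
    simp
  rw [hsigns, mul_assoc, mul_comm Z.toFinset.card] at hcount
  rw [Set.ncard_eq_toFinset_card']
  exact Nat.le_of_mul_le_mul_left hcount (pow_pos two_pos _)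
end
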